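/- arXiv:1810.07892 — 5 statements merged into one kernel-verified Lean document; each statement's English description precedes it below -/
import Mathlib

section
/- Let l ∈ {2,3,4} and let v = (1,0,−l) in the Mukai lattice, so that v² = 2l. Suppose u ∈ ℤ³ satisfies ⟨u, v−u⟩ > 0, u² ≥ 0, (v−u)² ≥ 0, ⟨u,v⟩² > u²·v², and ⟨v−u, v⟩² > (v−u)²·v². Then either (u² = 0 and 0 < ⟨u,v⟩ ≤ l) or ((v−u)² = 0 and 0 < ⟨v−u, v⟩ ≤ l). -/
/-- The Mukai pairing on `ℤ ⊕ ℤ ⊕ ℤ` with parameter `n` (so that `H² = 2n`):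
`⟨(x₀,x₁,x₂),(y₀,y₁,y₂)⟩ = 2n·x₁y₁ − x₀y₂ − x₂y₀`. -/
def mukai (n : ℤ) (x y : ℤ × ℤ × ℤ) : ℤ :=
  2 * n * x.2.1 * y.2.1 - x.1 * y.2.2 - x.2.2 * y.1

/-- The self-pairing of the Mukai lattice is even. -/
lemma even_mukai_self (n : ℤ) (x : ℤ × ℤ × ℤ) : Even (mukai n x x) :=
  ⟨n * x.2.1 * x.2.1 - x.1 * x.2.2, by unfold mukai; ring⟩

lemma mukai_add_left (n : ℤ) (x y z : ℤ × ℤ × ℤ) :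
    mukai n (x + y) z = mukai n x z + mukai n y z := by
  simp only [mukai, Prod.fst_add, Prod.snd_add]; ring

lemma mukai_comm (n : ℤ) (x y : ℤ × ℤ × ℤ) : mukai n x y = mukai n y x := by
  unfold mukai; ring

theorem stmt_0 (n : ℤ) (hn : 0 < n) (l : ℤ) (hl : l = 2 ∨ l = 3 ∨ l = 4)
    (v : ℤ × ℤ × ℤ) (hv : v = (1, 0, -l)) (u : ℤ × ℤ × ℤ)
    (h1 : 0 < mukai n u (v - u))
    (h2 : 0 ≤ mukai n u u)
    (h3 : 0 ≤ mukai n (v - u) (v - u))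
    (h4 : (mukai n u v) ^ 2 > mukai n u u * mukai n v v)
    (h5 : (mukai n (v - u) v) ^ 2 > mukai n (v - u) (v - u) * mukai n v v) :
    (mukai n u u = 0 ∧ 0 < mukai n u v ∧ mukai n u v ≤ l) ∨
    (mukai n (v - u) (v - u) = 0 ∧ 0 < mukai n (v - u) v ∧ mukai n (v - u) v ≤ l) := by
  have hvv : mukai n v v = 2 * l := by subst hv; simp only [mukai]; ring
  obtain ⟨w, hw⟩ : ∃ w, w = v - u := ⟨_, rfl⟩
  obtain rfl : v = u + w := by rw [hw]; abel
  rw [← hw] at h1 h3 ⊢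
  have huv : mukai n u (u + w) = mukai n u u + mukai n u w := by
    rw [mukai_comm, mukai_add_left, mukai_comm n w]
  have hwv : mukai n w (u + w) = mukai n u w + mukai n w w := by
    rw [mukai_comm, mukai_add_left]
  have hsum : mukai n (u + w) (u + w) = mukai n u u + 2 * mukai n u w + mukai n w w := by
    rw [mukai_add_left, huv, hwv]; ring
  obtain ⟨a, ha⟩ := even_mukai_self n u
  obtain ⟨b, hb⟩ := even_mukai_self n w
  rw [hsum] at h4 hvv
  rw [huv] at h4
  rw [huv, hwv]
  clear h5 huv hwv hsum
  generalize mukai n u w = c at *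
  rw [ha] at h2
  rw [hb] at h3
  rw [ha, hb] at h4 hvv ⊢
  rcases (show a = 0 ∨ 1 ≤ a by omega) with rfl | ha1
  · left; omega
  rcases (show b = 0 ∨ 1 ≤ b by omega) with rfl | hb1
  · right; omega
  -- the positivity hypothesis reads `4 * a * b < c ^ 2`, while `c = l - a - b ≤ 2`
  have hc : c ≤ 2 := by omega
  nlinarith [mul_nonneg (sub_nonneg.2 ha1) (sub_nonneg.2 hb1)]
end

section
/- Let n be a positive integer such that n/3 is not the square of a rational number. Then the equation 3Y² − nX² = 3 has a solution in positive integers, and if (X₁,Y₁) denotes its fundamental solution (the solution with X₁,Y₁ > 0 minimizing X among all solutions with X,Y > 0), and (X_k,Y_k) for k ≥ 1 is defined by the real identity Y_k + √(n/3)·X_k = (Y₁ + √(n/3)·X₁)^k, with (X₀,Y₀) := (0,1), then for every k ≥ 0 the numbers X_k, Y_k are nonnegative integers satisfying 3Y_k² − nX_k² = 3, X_k,Y_k > 0 for k ≥ 1, and the set of all integer solutions (X,Y) of 3Y² − nX² = 3 is exactly {(εX_k, ε′Y_k) : k ≥ 0, ε,ε′ ∈ {1,−1}}. -/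
/-- `(X, Y)` is an integer solution of the Pell-type equation `3Y² − nX² = 3`. -/
def IsPellSol (n X Y : ℤ) : Prop := 3 * Y ^ 2 - n * X ^ 2 = 3

/-- `(X₁, Y₁)` is the fundamental solution of `3Y² − nX² = 3`: a solution with
`X₁, Y₁ > 0` minimizing `X` among all solutions with `X, Y > 0`. -/
def IsFundamentalSol (n X₁ Y₁ : ℤ) : Prop :=
  0 < X₁ ∧ 0 < Y₁ ∧ IsPellSol n X₁ Y₁ ∧
    ∀ X Y : ℤ, 0 < X → 0 < Y → IsPellSol n X Y → X₁ ≤ X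

open Pell in
/-- Powers of a Pell solution, read as real numbers `x + s * y` with `s ^ 2 = d`. -/
theorem Pell.Solution₁.x_pow_add_mul_y_pow {d : ℤ} (a : Solution₁ d) {s : ℝ} (hs : s ^ 2 = d)
    (k : ℕ) : ((a ^ k).x : ℝ) + s * ((a ^ k).y : ℝ) = ((a.x : ℝ) + s * (a.y : ℝ)) ^ k := by
  induction k with
  | zero => simp
  | succ k ih =>
    rw [pow_succ (a.x + s * a.y : ℝ), ← ih, pow_succ a, Solution₁.x_mul, Solution₁.y_mul]
    push_cast
    rw [← hs]
    ring

/-- Integer coordinates with respect to `1` and an irrational number are unique. -/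
theorem Irrational.intCast_add_mul_intCast_inj {s : ℝ} (hs : Irrational s) {a b a' b' : ℤ}
    (h : (a : ℝ) + s * b = a' + s * b') : a = a' ∧ b = b' := by
  have hb : b = b' := by
    by_contra hne
    apply (hs.mul_intCast (sub_ne_zero.2 hne)).ne_int (a' - a)
    push_cast
    linarith
  subst hb
  exact ⟨by exact_mod_cast add_right_cancel h, rfl⟩

theorem irrational_sqrt_div_three {n : ℤ} (hn : 0 < n)
    (hirr : ¬ ∃ q : ℚ, (n : ℚ) / 3 = q ^ 2) : Irrational √((n : ℝ) / 3) := by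
  rintro ⟨q, hq⟩
  have hn' : (0 : ℝ) ≤ (n : ℝ) / 3 := by positivity
  refine hirr ⟨q, ?_⟩
  have h := Real.sq_sqrt hn'
  rw [← hq] at h
  exact_mod_cast h.symm

/-- The equation `3Y² − nX² = 3` reduces to a Pell equation `Y² − dZ² = 1` through `X = cZ`. -/
theorem exists_pell_reduction {n : ℤ} (hn : 0 < n) :
    ∃ c d : ℤ, 0 < c ∧ 0 < d ∧ n * c ^ 2 = 3 * d ∧ ∀ X Y : ℤ, IsPellSol n X Y → c ∣ X := by
  by_cases h : (3 : ℤ) ∣ n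
  · obtain ⟨m, rfl⟩ := h
    exact ⟨1, m, one_pos, by lia, by ring, fun X _ _ => one_dvd X⟩
  · refine ⟨3, 3 * n, by norm_num, by lia, by ring, fun X Y hXY => ?_⟩
    have hdvd : (3 : ℤ) ∣ n * X ^ 2 := ⟨Y ^ 2 - 1, by unfold IsPellSol at hXY; linarith⟩
    exact Int.prime_three.dvd_of_dvd_pow ((Int.prime_three.dvd_or_dvd hdvd).resolve_left h)

/-- Under `n * c² = 3 * d`, solutions `(cZ, Y)` of the Pell-type equation are the solutions
`(Y, Z)` of the Pell equation. -/
theorem isPellSol_mul_iff {n c d : ℤ} (hcd : n * c ^ 2 = 3 * d) (Y Z : ℤ) :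
    IsPellSol n (c * Z) Y ↔ Y ^ 2 - d * Z ^ 2 = 1 := by
  have h : 3 * Y ^ 2 - n * (c * Z) ^ 2 = 3 * (Y ^ 2 - d * Z ^ 2) := by
    linear_combination (-Z ^ 2) * hcd
  unfold IsPellSol
  rw [h]
  lia

theorem not_isSquare_of_mul_sq_eq {n c d : ℤ} (hc : 0 < c) (hcd : n * c ^ 2 = 3 * d)
    (hirr : ¬ ∃ q : ℚ, (n : ℚ) / 3 = q ^ 2) : ¬ IsSquare d := by
  rintro ⟨r, rfl⟩
  refine hirr ⟨r / c, ?_⟩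
  have hc' : (c : ℚ) ≠ 0 := by exact_mod_cast hc.ne'
  have hcd' : (n : ℚ) * c ^ 2 = 3 * (r * r) := by exact_mod_cast hcd
  field_simp
  linarith

open Pell in
theorem IsFundamentalSol.isFundamental {n c d Y₁ Z₁ : ℤ} (hc : 0 < c) (hd : 0 < d)
    (hcd : n * c ^ 2 = 3 * d) (h : IsFundamentalSol n (c * Z₁) Y₁)
    (hprop : Y₁ ^ 2 - d * Z₁ ^ 2 = 1) : IsFundamental (Solution₁.mk Y₁ Z₁ hprop) := by
  obtain ⟨hX, hY, -, hmin⟩ := h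
  have hZ : 0 < Z₁ := pos_of_mul_pos_right hX hc.le
  refine ⟨?_, hZ, fun {a} ha => ?_⟩
  · rw [Solution₁.x_mk]
    nlinarith [mul_pos hd (pow_pos hZ 2)]
  · rw [Solution₁.x_mk]
    have hy : 0 < |a.y| := abs_pos.2 (Solution₁.y_ne_zero_of_one_lt_x ha)
    have hle : c * Z₁ ≤ c * |a.y| := hmin _ a.x (mul_pos hc hy) (by lia)
      ((isPellSol_mul_iff hcd _ _).2 (by rw [sq_abs]; exact a.prop))
    have hle' : Z₁ ^ 2 ≤ a.y ^ 2 := by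
      rw [← sq_abs a.y]
      exact pow_le_pow_left₀ hZ.le (le_of_mul_le_mul_left hle hc) 2
    have hsq : Y₁ ^ 2 ≤ a.x ^ 2 := by
      have := a.prop
      nlinarith [mul_le_mul_of_nonneg_left hle' hd.le]
    exact abs_le_of_sq_le_sq' hsq (by lia) |>.2

theorem Int.exists_sign_mul_of_abs_eq {a b : ℤ} (h : |a| = b) :
    ∃ ε : ℤ, (ε = 1 ∨ ε = -1) ∧ a = ε * b := by
  rcases abs_choice a with h' | h'
  · exact ⟨1, Or.inl rfl, by lia⟩
  · exact ⟨-1, Or.inr rfl, by lia⟩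

open Pell in
theorem stmt_1 (n : ℤ) (hn : 0 < n) (hirr : ¬ ∃ q : ℚ, (n : ℚ) / 3 = q ^ 2) :
    (∃ X Y : ℤ, 0 < X ∧ 0 < Y ∧ IsPellSol n X Y) ∧
    ∀ X₁ Y₁ : ℤ, IsFundamentalSol n X₁ Y₁ →
      ∀ Xs Ys : ℕ → ℤ, Xs 0 = 0 → Ys 0 = 1 →
        (∀ k : ℕ, 1 ≤ k →
          (Ys k : ℝ) + Real.sqrt ((n : ℝ) / 3) * (Xs k : ℝ) =
            ((Y₁ : ℝ) + Real.sqrt ((n : ℝ) / 3) * (X₁ : ℝ)) ^ k) →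
        (∀ k : ℕ, 0 ≤ Xs k ∧ 0 ≤ Ys k ∧ IsPellSol n (Xs k) (Ys k)) ∧
        (∀ k : ℕ, 1 ≤ k → 0 < Xs k ∧ 0 < Ys k) ∧
        (∀ X Y : ℤ, IsPellSol n X Y ↔
          ∃ k : ℕ, ∃ ε ε' : ℤ, (ε = 1 ∨ ε = -1) ∧ (ε' = 1 ∨ ε' = -1) ∧
            X = ε * Xs k ∧ Y = ε' * Ys k) := by
  obtain ⟨c, d, hc, hd, hcd, hdvd⟩ := exists_pell_reduction hn
  refine ⟨?_, ?_⟩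
  · obtain ⟨a, hx, hy⟩ :=
      Solution₁.exists_pos_of_not_isSquare hd (not_isSquare_of_mul_sq_eq hc hcd hirr)
    exact ⟨c * a.y, a.x, mul_pos hc hy, by lia, (isPellSol_mul_iff hcd _ _).2 a.prop⟩
  intro X₁ Y₁ hfund Xs Ys hX0 hY0 hpow
  obtain ⟨Z₁, rfl⟩ := hdvd X₁ Y₁ hfund.2.2.1
  have hprop := (isPellSol_mul_iff hcd _ _).1 hfund.2.2.1
  have ha := hfund.isFundamental hc hd hcd hprop
  set a := Solution₁.mk Y₁ Z₁ hprop with ha_def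
  have hs : (√((n : ℝ) / 3) * c) ^ 2 = d := by
    have hcd' : (n : ℝ) * c ^ 2 = 3 * d := by exact_mod_cast hcd
    rw [mul_pow, Real.sq_sqrt (by positivity)]
    linarith
  have hseq : ∀ k, Ys k = (a ^ k).x ∧ Xs k = c * (a ^ k).y := by
    intro k
    rcases k.eq_zero_or_pos with rfl | hk
    · simp [hX0, hY0]
    · apply (irrational_sqrt_div_three hn hirr).intCast_add_mul_intCast_inj
      have h := a.x_pow_add_mul_y_pow hs k
      rw [ha_def, Solution₁.x_mk, Solution₁.y_mk, ← ha_def] at h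
      rw [hpow k hk]
      push_cast
      rw [← mul_assoc, ← mul_assoc, h]
  have hsol : ∀ k, IsPellSol n (Xs k) (Ys k) := by
    intro k
    rw [(hseq k).1, (hseq k).2]
    exact (isPellSol_mul_iff hcd _ _).2 (a ^ k).prop
  have hYpos : ∀ k, 0 < Ys k := fun k => (hseq k).1 ▸ Solution₁.x_pow_pos ha.x_pos k
  have hXpos : ∀ k, 1 ≤ k → 0 < Xs k := by
    intro k hk
    obtain ⟨m, rfl⟩ := Nat.exists_eq_succ_of_ne_zero (Nat.one_le_iff_ne_zero.1 hk)
    rw [(hseq _).2]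
    exact mul_pos hc (Solution₁.y_pow_succ_pos ha.x_pos ha.2.1 m)
  refine ⟨fun k => ⟨?_, (hYpos k).le, hsol k⟩, fun k hk => ⟨hXpos k hk, hYpos k⟩,
    fun X Y => ⟨fun h => ?_, ?_⟩⟩
  · rcases k.eq_zero_or_pos with rfl | hk
    · exact hX0.ge
    · exact (hXpos k hk).le
  · obtain ⟨Z, rfl⟩ := hdvd X Y h
    have hYZ := (isPellSol_mul_iff hcd _ _).1 h
    let b : Solution₁ d := Solution₁.mk |Y| |Z| (by rw [sq_abs, sq_abs]; exact hYZ)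
    have hbx : 0 < b.x := lt_of_le_of_ne (abs_nonneg Y) (b.x_ne_zero hd.le).symm
    obtain ⟨k, hk⟩ := ha.eq_pow_of_nonneg hbx (abs_nonneg Z)
    have hYk : |Y| = Ys k := by rw [(hseq k).1, ← hk]; rfl
    have hXk : |c * Z| = Xs k := by rw [(hseq k).2, ← hk, abs_mul, abs_of_pos hc]; rfl
    obtain ⟨ε, hε, hX⟩ := Int.exists_sign_mul_of_abs_eq hXk
    obtain ⟨ε', hε', hY⟩ := Int.exists_sign_mul_of_abs_eq hYk
    exact ⟨k, ε, ε', hε, hε', hX, hY⟩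
  · rintro ⟨k, ε, ε', hε, hε', rfl, rfl⟩
    have hk := hsol k
    unfold IsPellSol at hk ⊢
    rwa [mul_pow, mul_pow, sq_eq_one_iff.2 hε, sq_eq_one_iff.2 hε', one_mul,
      one_mul]
end

section
/- Let n be a positive integer and let X, Y be integers with 3Y² − nX² = 3. (a) If X is even, then Y is odd. (b) If 3 | X, then 3 ∤ Y, there is ε ∈ {1,−1} with 3 | (εY + 1), and for this ε one has gcd(εY + 1, X, 6) = 6 if X is even and gcd(εY + 1, X, 6) = 3 if X is odd. -/
theorem odd_of_even_of_three_mul_sq_sub {n X Y : ℤ} (hsol : 3 * Y ^ 2 - n * X ^ 2 = 3)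
    (hX : Even X) : Odd Y := by
  by_contra hY
  rw [Int.not_odd_iff_even] at hY
  have h : Even (3 * Y ^ 2 - n * X ^ 2) :=
    ((hY.pow_of_ne_zero two_ne_zero).mul_left 3).sub ((hX.pow_of_ne_zero two_ne_zero).mul_left n)
  rw [hsol] at h
  exact absurd h (by decide)

theorem not_three_dvd_of_three_mul_sq_sub {n X Y : ℤ} (hsol : 3 * Y ^ 2 - n * X ^ 2 = 3)
    (hX : (3 : ℤ) ∣ X) : ¬ (3 : ℤ) ∣ Y := by
  rintro ⟨b, rfl⟩
  obtain ⟨a, rfl⟩ := hX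
  have h : (9 : ℤ) ∣ 3 := ⟨3 * b ^ 2 - n * a ^ 2, by linarith⟩
  exact absurd h (by decide)

theorem gcd_gcd_six_eq_six {a b : ℤ} (ha₃ : (3 : ℤ) ∣ a) (hb₃ : (3 : ℤ) ∣ b)
    (ha : Even a) (hb : Even b) : Int.gcd (Int.gcd a b) 6 = 6 := by
  have ha₆ : (6 : ℤ) ∣ a := by have := ha.two_dvd; omega
  have hb₆ : (6 : ℤ) ∣ b := by have := hb.two_dvd; omega
  exact_mod_cast Int.gcd_eq_right (by norm_num) (Int.dvd_coe_gcd ha₆ hb₆)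

theorem gcd_gcd_six_eq_three {a b : ℤ} (ha₃ : (3 : ℤ) ∣ a) (hb₃ : (3 : ℤ) ∣ b)
    (hb : Odd b) : Int.gcd (Int.gcd a b) 6 = 3 := by
  have h₃ : (3 : ℤ) ∣ Int.gcd a b := Int.dvd_coe_gcd ha₃ hb₃
  have h₂ : ¬ (2 : ℤ) ∣ Int.gcd a b := fun h =>
    Int.not_even_iff_odd.mpr hb (even_iff_two_dvd.mpr (h.trans (Int.gcd_dvd_right a b)))
  have hmod : (Int.gcd a b : ℤ) % 6 = 3 := by omega
  rw [← Int.gcd_emod, hmod]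
  rfl

theorem stmt_6 (n : ℤ) (hn : 0 < n) (X Y : ℤ) (hsol : 3 * Y ^ 2 - n * X ^ 2 = 3) :
    (Even X → Odd Y) ∧
    ((3 : ℤ) ∣ X →
      ¬ (3 : ℤ) ∣ Y ∧
      ∃ ε : ℤ, (ε = 1 ∨ ε = -1) ∧ (3 : ℤ) ∣ (ε * Y + 1) ∧
        (Even X → Int.gcd (Int.gcd (ε * Y + 1) X) 6 = 6) ∧
        (Odd X → Int.gcd (Int.gcd (ε * Y + 1) X) 6 = 3)) := by
  refine ⟨odd_of_even_of_three_mul_sq_sub hsol, fun hX => ?_⟩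
  have hY := not_three_dvd_of_three_mul_sq_sub hsol hX
  obtain ⟨ε, hε, hdvd⟩ : ∃ ε : ℤ, (ε = 1 ∨ ε = -1) ∧ (3 : ℤ) ∣ (ε * Y + 1) := by
    by_cases h : (3 : ℤ) ∣ Y + 1
    · exact ⟨1, Or.inl rfl, by omega⟩
    · exact ⟨-1, Or.inr rfl, by omega⟩
  refine ⟨hY, ε, hε, hdvd, fun hX₂ => ?_, gcd_gcd_six_eq_three hdvd hX⟩
  have hε_odd : Odd ε := by rcases hε with rfl | rfl <;> decide
  exact gcd_gcd_six_eq_six hdvd hX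
    ((hε_odd.mul (odd_of_even_of_three_mul_sq_sub hsol hX₂)).add_one) hX₂
end

section
/- Let n be a positive integer, v := (1,0,−3) in the Mukai lattice, and let u ∈ ℤ³ satisfy ⟨u,u⟩ = 0 and c := ⟨u,v⟩ ∈ {1,2,3}. Then there exist integers X, Y such that 6·u = c·(1 + Y, X, 3(Y − 1)) (componentwise in ℤ³) and 3Y² − nX² = 3; moreover 6/c divides gcd(Y + 1, X, 6). -/
/-- For `c * k = 6`, an isotropic `(a, b, d)` with `c = 3 * a - d` gives the solution
`(k * b, k * a - 1)` of `3 * Y ^ 2 - n * X ^ 2 = 3`. -/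
theorem pell_of_isotropic {n a b d c k : ℤ} (hiso : n * b ^ 2 = a * d) (hc : c = 3 * a - d)
    (hk : c * k = 6) : 3 * (k * a - 1) ^ 2 - n * (k * b) ^ 2 = 3 := by
  subst hc
  linear_combination (-k ^ 2) * hiso + k * a * hk

theorem stmt_14 (n : ℤ) (hn : 0 < n) (u : ℤ × ℤ × ℤ)
    (hiso : mukai n u u = 0) (c : ℤ) (hc : c = mukai n u (1, 0, -3))
    (hc' : c = 1 ∨ c = 2 ∨ c = 3) :
    ∃ X Y : ℤ, (6 : ℤ) • u = c • (((1 + Y, X, 3 * (Y - 1))) : ℤ × ℤ × ℤ) ∧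
      3 * Y ^ 2 - n * X ^ 2 = 3 ∧
      (6 / c) ∣ ((Int.gcd (Int.gcd (Y + 1) X) 6 : ℤ)) := by
  obtain ⟨a, b, d⟩ := u
  simp only [mukai] at hiso hc
  have hk : c * (6 / c) = 6 := by rcases hc' with rfl | rfl | rfl <;> norm_num
  generalize 6 / c = k at hk ⊢
  have hc₀ : c = 3 * a - d := by linear_combination hc
  refine ⟨k * b, k * a - 1, ?_, pell_of_isotropic (by linarith) hc₀ hk, ?_⟩
  · simp only [Prod.smul_mk, smul_eq_mul, Prod.mk.injEq]
    refine ⟨?_, ?_, ?_⟩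
    · linear_combination (-a) * hk
    · linear_combination (-b) * hk
    · linear_combination (-3 * a) * hk + 6 * hc₀
  · refine Int.dvd_coe_gcd (Int.dvd_coe_gcd ?_ (dvd_mul_right k b)) (Dvd.intro_left c hk)
    exact ⟨a, by ring⟩
end

section
/- Let n be a positive integer and let X, Y be integers with 3Y² − nX² = 3. Suppose d := gcd(Y + 1, X, 6) belongs to {2, 3, 6}. Then u := ((Y+1)/d, X/d, 3(Y−1)/d) is a vector with integer entries, and in the Mukai lattice it satisfies ⟨u,u⟩ = 0 and ⟨u, (1,0,−3)⟩ = 6/d. -/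
theorem stmt_15 (n : ℤ) (hn : 0 < n) (X Y : ℤ) (hsol : 3 * Y ^ 2 - n * X ^ 2 = 3)
    (d : ℤ) (hd : d = Int.gcd (Int.gcd (Y + 1) X) 6)
    (hd' : d = 2 ∨ d = 3 ∨ d = 6) :
    ∃ a b c : ℤ, d * a = Y + 1 ∧ d * b = X ∧ d * c = 3 * (Y - 1) ∧
      mukai n (a, b, c) (a, b, c) = 0 ∧
      mukai n (a, b, c) (1, 0, -3) = 6 / d := by
  have hd0 : d ≠ 0 := by omega
  obtain ⟨k, hk⟩ : d ∣ 6 := hd ▸ Int.gcd_dvd_right _ _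
  have hdg : d ∣ (Int.gcd (Y + 1) X : ℤ) := hd ▸ Int.gcd_dvd_left _ _
  obtain ⟨a, ha⟩ : d ∣ Y + 1 := hdg.trans (Int.gcd_dvd_left _ _)
  obtain ⟨b, hb⟩ : d ∣ X := hdg.trans (Int.gcd_dvd_right _ _)
  refine ⟨a, b, 3 * a - k, ha.symm, hb.symm, by linear_combination hk - 3 * ha, ?_, ?_⟩
  · obtain rfl : Y = d * a - 1 := by linarith
    subst hb
    refine mul_left_cancel₀ (pow_ne_zero 2 hd0) ?_
    simp only [mukai]
    linear_combination -2 * hsol - 2 * a * d * hk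
  · rw [hk, Int.mul_ediv_cancel_left _ hd0]
    simp only [mukai]
    ring
end
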